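/- For all positive integers d, l, r, s, t there are positive integers f = f(d,l,r,s,t) and g = g(d,l,r,s,t) with the following property. Let 𝔠 be an (f,g)-constellation. Then one of the following holds: (a) 𝔠 has an induced subgraph isomorphic to K_{r,r} or to a proper subdivision of K_{2t+2}; or (b) there is a d-ample and (2t,2t,2t)-mixed (s,l)-constellation 𝔟 which sits in 𝔠. -/

import Mathlib

open SimpleGraph

/-- Two vertex sets `X` and `Y` are *anticomplete* in `G` if they are disjoint and
there is no edge of `G` with an end in each. -/
def Anticomplete {V : Type} (G : SimpleGraph V) (X Y : Set V) : Prop :=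
  Disjoint X Y ∧ ∀ x ∈ X, ∀ y ∈ Y, ¬ G.Adj x y

/-- `G` has an induced subgraph isomorphic to `H`. -/
def HasInducedSubgraphIso {V W : Type} (G : SimpleGraph V) (H : SimpleGraph W) : Prop :=
  ∃ X : Set V, Nonempty (H ≃g G.induce X)

/-- `G` has an induced minor isomorphic to `H`, witnessed by branch sets. -/
def HasInducedMinor {V W : Type} (G : SimpleGraph V) (H : SimpleGraph W) : Prop :=
  ∃ B : W → Set V,
    (∀ w, (G.induce (B w)).Connected) ∧
    (Pairwise fun u v => Disjoint (B u) (B v)) ∧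
    (∀ u v : W, u ≠ v → (H.Adj u v ↔ ¬ Anticomplete G (B u) (B v)))

/-- The set `P` induces a path in `G`. -/
def IsPathSet {V : Type} (G : SimpleGraph V) (P : Set V) : Prop :=
  ∃ n : ℕ, Nonempty (G.induce P ≃g pathGraph (n + 1))

/-- The vertex sets of the connected components of the subgraph of `G` induced on `X`. -/
def CompsOn {V : Type} (G : SimpleGraph V) (X : Set V) : Set (Set V) :=
  {L | ∃ C : (G.induce X).ConnectedComponent, L = Subtype.val '' C.supp}

/-- The induced subgraph of `G` on `W` together with the stable set `S ⊆ W` forms a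
constellation: every component of `W \ S` is a path and every vertex of `S` has a
neighbor in every such component. -/
structure IsConstellationOn {V : Type} (G : SimpleGraph V) (W S : Set V) : Prop where
  subset : S ⊆ W
  stable : ∀ x ∈ S, ∀ y ∈ S, ¬ G.Adj x y
  comp_paths : ∀ L ∈ CompsOn G (W \ S), IsPathSet G L
  dominates : ∀ x ∈ S, ∀ L ∈ CompsOn G (W \ S), ∃ y ∈ L, G.Adj x y

/-- `p` is a route of the constellation `(W, S)` in `G`: an induced path of the induced
subgraph of `G` on `W`, with its two (distinct) ends in `S` and its interior outside `S`. -/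
structure IsRoute {V : Type} (G : SimpleGraph V) (W S : Set V) {x y : V}
    (p : G.Walk x y) : Prop where
  ne : x ≠ y
  isPath : p.IsPath
  induced : ∀ u v, u ∈ p.support → v ∈ p.support → G.Adj u v → p.toSubgraph.Adj u v
  support_mem : ∀ v ∈ p.support, v ∈ W
  fst_mem : x ∈ S
  snd_mem : y ∈ S
  interior : ∀ v ∈ p.support, v ≠ x → v ≠ y → v ∉ S

/-- The constellation `(W, S)` in `G` is `d`-ample: no route has length at most `d+1`. -/
def DAmple {V : Type} (G : SimpleGraph V) (W S : Set V) (d : ℕ) : Prop :=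
  ∀ ⦃x y : V⦄ (p : G.Walk x y), IsRoute G W S p → d + 1 < p.length

/-- The constellation `(W, S)` in `G` is interrupted with respect to some linear order
(encoded by an injective-on-`S` function `f : V → ℕ`). -/
def Interrupted {V : Type} (G : SimpleGraph V) (W S : Set V) : Prop :=
  ∃ f : V → ℕ, Set.InjOn f S ∧
    ∀ x ∈ S, ∀ y ∈ S, ∀ z ∈ S, f x < f y → f y < f z →
      ∀ (p : G.Walk x y), IsRoute G W S p → ∃ v ∈ p.support, G.Adj z v

/-- The constellation `(W, S)` in `G` is `q`-zigzagged. -/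
def Zigzagged {V : Type} (G : SimpleGraph V) (W S : Set V) (q : ℕ) : Prop :=
  ∃ f : V → ℕ, Set.InjOn f S ∧
    ∀ x ∈ S, ∀ y ∈ S, f x < f y →
      ∀ (p : G.Walk x y), IsRoute G W S p →
        {z | z ∈ S ∧ f x < f z ∧ f z < f y ∧ ¬ ∃ v ∈ p.support, G.Adj z v}.ncard < q

/-- The constellation `(W, S)` in `G` is `(qm, q, qp)`-mixed. -/
def Mixed {V : Type} (G : SimpleGraph V) (W S : Set V) (qm q qp : ℕ) : Prop :=
  ∃ f : V → ℕ, Set.InjOn f S ∧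
    ∀ x ∈ S, ∀ y ∈ S, f x < f y →
      ∀ (p : G.Walk x y), IsRoute G W S p →
        ∀ Qm Q Qp : Set V, Qm ⊆ S → Q ⊆ S → Qp ⊆ S →
          Qm.ncard = qm → Q.ncard = q → Qp.ncard = qp →
          (∀ z ∈ Qm, f z < f x) → (∀ z ∈ Q, f x < f z ∧ f z < f y) →
          (∀ z ∈ Qp, f y < f z) →
          ∃ z ∈ Qm ∪ Q ∪ Qp, ∃ v ∈ p.support, G.Adj z v

/-- The constellation `(W', S')` sits in the constellation `(W, S)` (both within `G`). -/
def SitsIn {V : Type} (G : SimpleGraph V) (W' S' W S : Set V) : Prop :=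
  W' ⊆ W ∧ S' ⊆ S ∧
  (∀ L ∈ CompsOn G (W' \ S'), ∃ M ∈ CompsOn G (W \ S), L ⊆ M) ∧
  (∀ M ∈ CompsOn G (W \ S), ∀ L₁ ∈ CompsOn G (W' \ S'), ∀ L₂ ∈ CompsOn G (W' \ S'),
      L₁ ⊆ M → L₂ ⊆ M → L₁ = L₂)

/-- A witness that `S` is a subdivision of `H`, where each edge of `H` is replaced by a
path whose length satisfies `ok`. -/
structure SubdivModel {U W : Type} (S : SimpleGraph U) (H : SimpleGraph W)
    (ok : ℕ → Prop) where
  b : W → U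
  b_inj : Function.Injective b
  path : ∀ ⦃u v : W⦄, H.Adj u v → S.Walk (b u) (b v)
  path_isPath : ∀ ⦃u v : W⦄ (h : H.Adj u v), (path h).IsPath
  path_len : ∀ ⦃u v : W⦄ (h : H.Adj u v), ok (path h).length
  path_symm : ∀ ⦃u v : W⦄ (h : H.Adj u v), path h.symm = (path h).reverse
  branch_avoid : ∀ ⦃u v : W⦄ (h : H.Adj u v) (w : W), b w ∈ (path h).support → w = u ∨ w = v
  interiors_anticomplete :
    ∀ ⦃u v u' v' : W⦄ (h : H.Adj u v) (h' : H.Adj u' v'),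
      (s(u, v) : Sym2 W) ≠ s(u', v') →
      ∀ x ∈ (path h).support, x ≠ b u → x ≠ b v →
      ∀ y ∈ (path h').support, y ≠ b u' → y ≠ b v' →
        x ≠ y ∧ ¬ S.Adj x y
  cover : ∀ x : U, (∃ w, x = b w) ∨ ∃ (u v : W) (h : H.Adj u v), x ∈ (path h).support
  edges_eq : ∀ x y : U, S.Adj x y → ∃ (u v : W) (h : H.Adj u v), (path h).toSubgraph.Adj x y

/-- `S` is a subdivision of `H` with path lengths satisfying `ok`. -/
def IsSubdivisionWith {U W : Type} (S : SimpleGraph U) (H : SimpleGraph W)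
    (ok : ℕ → Prop) : Prop :=
  Nonempty (SubdivModel S H ok)

/-- The line graph of `G`. -/
def LineGraph {V : Type} (G : SimpleGraph V) : SimpleGraph G.edgeSet :=
  SimpleGraph.fromRel (fun e f => ∃ v : V, v ∈ (e : Sym2 V) ∧ v ∈ (f : Sym2 V))

/-- The `r`-by-`r` hexagonal wall (brick wall). -/
def Wall (r : ℕ) : SimpleGraph (Fin r × Fin (2 * r)) :=
  SimpleGraph.fromRel (fun a b =>
    (a.1 = b.1 ∧ a.2.val + 1 = b.2.val) ∨
    (a.2 = b.2 ∧ a.1.val + 1 = b.1.val ∧ (a.1.val + a.2.val) % 2 = 0))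

/-- The full binary tree of radius `r`, on `2^(r+1) - 1` vertices (heap indexing). -/
def BinTree (r : ℕ) : SimpleGraph (Fin (2 ^ (r + 1) - 1)) :=
  SimpleGraph.fromRel (fun a b =>
    b.val + 1 = 2 * (a.val + 1) ∨ b.val + 1 = 2 * (a.val + 1) + 1)

/-- The leaf-extension of `H` by leaves `L` attached via `f`. -/
def leafExt {W : Type} (H : SimpleGraph W) (L : Type) (f : L → W) :
    SimpleGraph (W ⊕ L) :=
  SimpleGraph.fromRel (fun a b =>
    match a, b with
    | Sum.inl a, Sum.inl b => H.Adj a b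
    | Sum.inl a, Sum.inr x => f x = a
    | _, _ => False)

/-- `G` has treewidth at most `k` (via tree decompositions). -/
def TreewidthLE {V : Type} (G : SimpleGraph V) (k : ℕ) : Prop :=
  ∃ (ι : Type) (T : SimpleGraph ι) (bag : ι → Set V),
    T.IsTree ∧
    (∀ v, ∃ i, v ∈ bag i) ∧
    (∀ u v, G.Adj u v → ∃ i, u ∈ bag i ∧ v ∈ bag i) ∧
    (∀ v, (T.induce {i | v ∈ bag i}).Connected) ∧
    (∀ i, (bag i).ncard ≤ k + 1)

/-- `G` has pathwidth at most `k` (via path decompositions). -/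
def PathwidthLE {V : Type} (G : SimpleGraph V) (k : ℕ) : Prop :=
  ∃ (n : ℕ) (bag : Fin n → Set V),
    (∀ v, ∃ i, v ∈ bag i) ∧
    (∀ u v, G.Adj u v → ∃ i, u ∈ bag i ∧ v ∈ bag i) ∧
    (∀ (v : V) (i j k' : Fin n), i ≤ j → j ≤ k' → v ∈ bag i → v ∈ bag k' → v ∈ bag j) ∧
    (∀ i, (bag i).ncard ≤ k + 1)

/-- An induced `(s,t)`-model in `G`. -/
def IsInducedModel {V : Type} (G : SimpleGraph V) {s t : ℕ}
    (A : Fin s → Set V) (B : Fin t → Set V) : Prop :=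
  (∀ i, (G.induce (A i)).Connected) ∧
  (∀ j, (G.induce (B j)).Connected) ∧
  (∀ i j : Fin s, i ≠ j → Anticomplete G (A i) (A j)) ∧
  (∀ i j : Fin t, i ≠ j → Anticomplete G (B i) (B j)) ∧
  (∀ (i : Fin s) (j : Fin t), Disjoint (A i) (B j) ∧ ¬ Anticomplete G (A i) (B j))

/-- The `A`-contraction of a model: each `A i` is contracted to the vertex `Sum.inl i`. -/
def AContraction {V : Type} (G : SimpleGraph V) {s t : ℕ}
    (A : Fin s → Set V) (B : Fin t → Set V) :
    SimpleGraph (Fin s ⊕ (⋃ j, B j : Set V)) :=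
  SimpleGraph.fromRel (fun x y =>
    match x, y with
    | Sum.inl i, Sum.inl i' => i ≠ i' ∧ ∃ a ∈ A i, ∃ a' ∈ A i', G.Adj a a'
    | Sum.inl i, Sum.inr b => ∃ a ∈ A i, G.Adj a ↑b
    | Sum.inr b, Sum.inr b' => G.Adj ↑b ↑b'
    | _, _ => False)

/-- A linear induced model is `d`-`A`-ample if its `A`-contraction is `d`-ample. -/
def ModelAAmple {V : Type} (G : SimpleGraph V) {s t : ℕ}
    (A : Fin s → Set V) (B : Fin t → Set V) (d : ℕ) : Prop :=
  DAmple (AContraction G A B) Set.univ (Set.range Sum.inl) d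

/-- A linear induced model is `d`-ample if it is `d`-`A`-ample and `d`-`B`-ample. -/
def ModelAmple {V : Type} (G : SimpleGraph V) {s t : ℕ}
    (A : Fin s → Set V) (B : Fin t → Set V) (d : ℕ) : Prop :=
  ModelAAmple G A B d ∧ ModelAAmple G B A d

/-- The zigzag sequences. -/
def Zseq : ℕ → List ℤ
  | 0 => []
  | 1 => [1]
  | 2 => [1, 2]
  | 3 => [1, 2, 3]
  | n + 4 =>
      (Zseq (n + 3)).dropLast ++ (((Zseq (n + 2)).map (· + 1)).reverse).dropLast
        ++ (Zseq (n + 3)).map (· + 1)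

/-- Collapse each maximal run of consecutive equal entries to a single entry. -/
def collapse (l : List ℤ) : List ℤ := l.destutter (· ≠ ·)

/-- `B` is an alignment in the sequence `A`. -/
def IsAlignment (A : List ℤ) (B : Finset ℤ) : Prop :=
  (∀ b ∈ B, b ∈ A) ∧
  ∃ i j : ℕ, i ≤ j ∧ j < A.length ∧
    ∀ b ∈ B,
      (collapse (((A.take (j + 1)).drop i).filter (fun a => decide (a ∈ B)))).count b = 1

/-- Finite Ramsey theorem for `k`-element subsets of a linearly ordered set. -/
theorem exists_ramsey_number (κ : Type) [Finite κ] (k m : ℕ) :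
    ∃ N : ℕ, ∀ (α : Type) [LinearOrder α] (T : Finset α) (c : Finset α → κ), N ≤ T.card →
      ∃ U ⊆ T, U.card = m ∧ ∃ a, ∀ A ⊆ U, A.card = k → c A = a := by
  classical
  have := Fintype.ofFinite κ
  induction k generalizing m with
  | zero =>
    refine ⟨m, fun α _ T c hT => ?_⟩
    obtain ⟨U, hU, hm⟩ := Finset.exists_subset_card_eq hT
    refine ⟨U, hU, hm, c ∅, fun A _ hA => ?_⟩
    rw [Finset.card_eq_zero.1 hA]
  | succ k ih =>
    have key : ∀ n : ℕ, ∃ N : ℕ, ∀ (α : Type) [LinearOrder α] (T : Finset α) (c : Finset α → κ),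
        N ≤ T.card → ∃ U ⊆ T, U.card = n ∧ ∃ φ : α → κ, ∀ A ⊆ U, A.card = k + 1 →
          ∀ x ∈ A, (∀ y ∈ A, x ≤ y) → c A = φ x := by
      intro n
      induction n with
      | zero =>
        refine ⟨0, fun α _ T c _ => ⟨∅, by simp, rfl, fun _ => c ∅, fun A hA hk => ?_⟩⟩
        rw [Finset.subset_empty.1 hA] at hk
        simp at hk
      | succ n ihn =>
        obtain ⟨N, hN⟩ := ihn
        obtain ⟨R, hR⟩ := ih N
        refine ⟨R + 1, fun α _ T c hT => ?_⟩
        have hne : T.Nonempty := Finset.card_pos.1 (by omega)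
        set x := T.min' hne
        have hx : x ∈ T := T.min'_mem hne
        obtain ⟨U, hU, hUc, a, ha⟩ := hR α (T.erase x) (fun B => c (insert x B))
          (by rw [Finset.card_erase_of_mem hx]; omega)
        obtain ⟨U', hU', hUc', φ, hφ⟩ := hN α U c hUc.ge
        have hxU : x ∉ U' := fun h => by simpa using hU (hU' h)
        refine ⟨insert x U', ?_, by rw [Finset.card_insert_of_notMem hxU, hUc'],
          Function.update φ x a, fun A hA hk y hy hmin => ?_⟩
        · intro z hz
          rcases Finset.mem_insert.1 hz with rfl | hz
          · exact hx
          · exact Finset.mem_of_mem_erase (hU (hU' hz))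
        · by_cases hxA : x ∈ A
          · have hyx : y = x := by
              refine le_antisymm (hmin x hxA) (T.min'_le _ ?_)
              rcases Finset.mem_insert.1 (hA hy) with rfl | h
              · exact hx
              · exact Finset.mem_of_mem_erase (hU (hU' h))
            have := ha (A.erase x) (fun z hz => hU' ?_)
              (by rw [Finset.card_erase_of_mem hxA]; omega)
            · rw [hyx, Function.update_self, ← this, Finset.insert_erase hxA]
            · have h := hA (Finset.mem_of_mem_erase hz)
              exact (Finset.mem_insert.1 h).resolve_left (Finset.ne_of_mem_erase hz)
          · rw [Function.update_of_ne (fun h : y = x => hxA (h ▸ hy))]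
            exact hφ A ((Finset.subset_insert_iff_of_notMem hxA).1 hA) hk y hy hmin
    obtain ⟨N, hN⟩ := key (Fintype.card κ * m)
    refine ⟨N, fun α _ T c hT => ?_⟩
    obtain ⟨U, hU, hUc, φ, hφ⟩ := hN α T c hT
    obtain ⟨a, -, ha⟩ := Finset.exists_le_card_fiber_of_mul_le_card_of_maps_to
      (s := U) (t := Finset.univ) (f := φ) (n := m) (by simp) ⟨c ∅, by simp⟩ (by simp [hUc])
    obtain ⟨U', hU', hUc'⟩ := Finset.exists_subset_card_eq ha
    refine ⟨U', fun z hz => hU (Finset.mem_filter.1 (hU' hz)).1, hUc', a, fun A hA hk => ?_⟩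
    have hne : A.Nonempty := Finset.card_pos.1 (by omega)
    have hmem := A.min'_mem hne
    rw [hφ A (fun z hz => (Finset.mem_filter.1 (hU' (hA hz))).1) hk _ hmem
      (fun y hy => A.min'_le y hy)]
    exact (Finset.mem_filter.1 (hU' (hA hmem))).2

/-- A large finite set contains a sequence whose gaps, including the two outer ones, are all of
size at least `n`. -/
theorem exists_spaced_sequence {α : Type} [LinearOrder α] (T : Finset α) (n m : ℕ)
    (hT : (n + 1) * (m + 1) < T.card) :
    ∃ b : Fin m → α, StrictMono b ∧ (∀ j, b j ∈ T) ∧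
      (∀ j, n ≤ (T.filter (· < b j)).card) ∧
      (∀ i j, i < j → n ≤ (T.filter (fun z => b i < z ∧ z < b j)).card) ∧
      (∀ j, n ≤ (T.filter (b j < ·)).card) := by
  classical
  set M := T.card with hM
  set τ : Fin M ↪o α := T.orderEmbOfFin rfl
  have hτ : ∀ i, τ i ∈ T := T.orderEmbOfFin_mem rfl
  have gap : ∀ (p : α → Prop) [DecidablePred p] (a : ℕ), (ha : a + n ≤ M) →
      (∀ k : Fin M, a ≤ k → k < a + n → p (τ k)) → n ≤ (T.filter p).card := by
    intro p _ a ha h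
    have : (Finset.univ.map ⟨fun i : Fin n => τ ⟨a + i, by omega⟩, fun i j hij => by
        have := τ.injective hij
        simp only [Fin.mk.injEq] at this
        exact Fin.ext (by omega)⟩) ⊆ T.filter p := by
      intro z hz
      obtain ⟨i, -, rfl⟩ := Finset.mem_map.1 hz
      refine Finset.mem_filter.2 ⟨hτ _, h _ ?_ ?_⟩ <;> simp
    simpa using Finset.card_le_card this
  have hlt : ∀ j : Fin m, (n + 1) * (j + 1) + n < M := fun j => by
    have : (n + 1) * (j + 2) ≤ (n + 1) * (m + 1) := Nat.mul_le_mul_left _ (by omega)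
    nlinarith
  have hstep : ∀ i j : Fin m, i < j → (n + 1) * (i + 1) + (n + 1) ≤ (n + 1) * (j + 1) :=
    fun i j hij => by
      have : (n + 1) * (i + 2) ≤ (n + 1) * (j + 1) := Nat.mul_le_mul_left _ (by
        have : (i : ℕ) < j := hij
        omega)
      nlinarith
  have hpos : ∀ j : Fin m, n < (n + 1) * (j + 1) := fun j => by nlinarith [j.2]
  refine ⟨fun j => τ ⟨(n + 1) * (j + 1), by have := hlt j; omega⟩, fun i j hij => ?_,
    fun j => hτ _, fun j => ?_, fun i j hij => ?_, fun j => ?_⟩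
  · have := hstep i j hij
    exact τ.strictMono (Fin.mk_lt_mk.2 (by omega))
  · have := hpos j
    have := hlt j
    refine gap _ 0 (by omega) fun k _ hk => τ.strictMono (Fin.lt_def.2 ?_)
    simp only
    omega
  · have := hstep i j hij
    have := hlt j
    refine gap _ ((n + 1) * (i + 1) + 1) (by omega) fun k h1 h2 =>
      ⟨τ.strictMono (Fin.lt_def.2 ?_), τ.strictMono (Fin.lt_def.2 ?_)⟩ <;> simp only <;> omega
  · have := hlt j
    refine gap _ ((n + 1) * (j + 1) + 1) (by omega) fun k h1 h2 =>
      τ.strictMono (Fin.lt_def.2 ?_)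
    simp only
    omega

/-- The elements `x < y` of `A` have exactly `n` elements of `A` below, between and above them. -/
structure IsSplit {α : Type} [LinearOrder α] (A : Finset α) (n : ℕ) (x y : α) : Prop where
  fst_mem : x ∈ A
  snd_mem : y ∈ A
  lt : x < y
  card_below : (A.filter (· < x)).card = n
  card_between : (A.filter (fun z => x < z ∧ z < y)).card = n
  card_above : (A.filter (y < ·)).card = n

theorem IsSplit.unique {α : Type} [LinearOrder α] {A : Finset α} {n : ℕ} {x y x' y' : α}
    (h : IsSplit A n x y) (h' : IsSplit A n x' y') : x = x' ∧ y = y' := by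
  have below : ∀ {u v : α}, u ∈ A → u < v → (A.filter (· < u)).card < (A.filter (· < v)).card :=
    fun {u v} hu huv => Finset.card_lt_card (Finset.ssubset_iff_of_subset
      (Finset.monotone_filter_right A fun z _ (hz : z < u) => hz.trans huv) |>.2
      ⟨u, by simp [hu, huv], by simp⟩)
  have above : ∀ {u v : α}, v ∈ A → u < v → (A.filter (v < ·)).card < (A.filter (u < ·)).card :=
    fun {u v} hv huv => Finset.card_lt_card (Finset.ssubset_iff_of_subset
      (Finset.monotone_filter_right A fun z _ (hz : v < z) => huv.trans hz) |>.2
      ⟨v, by simp [hv, huv], by simp⟩)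
  constructor
  · rcases lt_trichotomy x x' with hlt | heq | hlt
    · exact absurd (below h.fst_mem hlt) (by rw [h.card_below, h'.card_below]; exact lt_irrefl _)
    · exact heq
    · exact absurd (below h'.fst_mem hlt) (by rw [h.card_below, h'.card_below]; exact lt_irrefl _)
  · rcases lt_trichotomy y y' with hlt | heq | hlt
    · exact absurd (above h'.snd_mem hlt) (by rw [h.card_above, h'.card_above]; exact lt_irrefl _)
    · exact heq
    · exact absurd (above h.snd_mem hlt) (by rw [h.card_above, h'.card_above]; exact lt_irrefl _)

theorem isSplit_insert_union {α : Type} [LinearOrder α] {n : ℕ} {x y : α} (hxy : x < y)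
    {Qm Q Qp : Finset α} (hm : ∀ z ∈ Qm, z < x) (hq : ∀ z ∈ Q, x < z ∧ z < y)
    (hp : ∀ z ∈ Qp, y < z) (cm : Qm.card = n) (cq : Q.card = n) (cp : Qp.card = n) :
    IsSplit (insert x (insert y (Qm ∪ Q ∪ Qp))) n x y ∧
      (insert x (insert y (Qm ∪ Q ∪ Qp))).card = 3 * n + 2 := by
  have e1 : (insert x (insert y (Qm ∪ Q ∪ Qp))).filter (· < x) = Qm := by
    ext z; simp only [Finset.mem_filter, Finset.mem_insert, Finset.mem_union]; grind
  have e2 : (insert x (insert y (Qm ∪ Q ∪ Qp))).filter (fun z => x < z ∧ z < y) = Q := by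
    ext z; simp only [Finset.mem_filter, Finset.mem_insert, Finset.mem_union]; grind
  have e3 : (insert x (insert y (Qm ∪ Q ∪ Qp))).filter (y < ·) = Qp := by
    ext z; simp only [Finset.mem_filter, Finset.mem_insert, Finset.mem_union]; grind
  refine ⟨⟨by simp, by simp, hxy, by rw [e1, cm], by rw [e2, cq], by rw [e3, cp]⟩, ?_⟩
  have d1 : Disjoint Qm Q := Finset.disjoint_left.2 fun z h1 h2 => by grind
  have d2 : Disjoint (Qm ∪ Q) Qp := Finset.disjoint_left.2 fun z h1 h2 => by grind
  rw [Finset.card_insert_of_notMem, Finset.card_insert_of_notMem,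
    Finset.card_union_of_disjoint d2, Finset.card_union_of_disjoint d1, cm, cq, cp]
  · ring
  · grind
  · grind

section Components

variable {V : Type} {G : SimpleGraph V}

theorem subset_of_mem_compsOn {X L : Set V} (h : L ∈ CompsOn G X) : L ⊆ X := by
  obtain ⟨C, rfl⟩ := h
  rintro _ ⟨⟨v, hv⟩, -, rfl⟩
  exact hv

theorem nonempty_of_mem_compsOn {X L : Set V} (h : L ∈ CompsOn G X) : L.Nonempty := by
  obtain ⟨C, rfl⟩ := h
  exact C.nonempty_supp.image _

theorem exists_mem_compsOn {X : Set V} {v : V} (hv : v ∈ X) : ∃ L ∈ CompsOn G X, v ∈ L :=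
  ⟨_, ⟨(G.induce X).connectedComponentMk ⟨v, hv⟩, rfl⟩, ⟨v, hv⟩, rfl, rfl⟩

theorem mem_compsOn_of_adj {X L : Set V} (h : L ∈ CompsOn G X) {u v : V} (hu : u ∈ L)
    (hv : v ∈ X) (huv : G.Adj u v) : v ∈ L := by
  obtain ⟨C, rfl⟩ := h
  obtain ⟨⟨u, hu'⟩, hC, rfl⟩ := hu
  refine ⟨⟨v, hv⟩, ?_, rfl⟩
  exact C.mem_supp_of_adj_mem_supp hC (by simpa using huv)

theorem compsOn_eq_of_mem {X L M : Set V} (hL : L ∈ CompsOn G X) (hM : M ∈ CompsOn G X) {u : V}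
    (hu : u ∈ L) (hu' : u ∈ M) : L = M := by
  obtain ⟨C, rfl⟩ := hL
  obtain ⟨D, rfl⟩ := hM
  obtain ⟨⟨u, h⟩, hC, rfl⟩ := hu
  obtain ⟨⟨w, h'⟩, hD, rfl⟩ := hu'
  rw [ConnectedComponent.mem_supp_iff] at hC hD
  rw [← hC, ← hD]

/-- The components of a union of components are the components in the union. -/
theorem compsOn_sUnion {X : Set V} {F : Set (Set V)} (hF : F ⊆ CompsOn G X) :
    CompsOn G (⋃₀ F) = F := by
  have hsub : ⋃₀ F ⊆ X := Set.sUnion_subset fun L hL => subset_of_mem_compsOn (hF hL)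
  have reach : ∀ {L : Set V} (hL : L ∈ F) {a b : X} (p : (G.induce X).Walk a b) (ha : a.1 ∈ L),
      ∃ hb : b.1 ∈ L, (G.induce (⋃₀ F)).Reachable ⟨a, L, hL, ha⟩ ⟨b, L, hL, hb⟩ := by
    intro L hL a b p
    induction p with
    | nil => exact fun ha => ⟨ha, Reachable.refl _⟩
    | @cons u v w h p ih =>
      intro ha
      have huv : G.Adj u.1 v.1 := by simpa using h
      have hv := mem_compsOn_of_adj (hF hL) ha v.2 huv
      obtain ⟨hb, hr⟩ := ih hv
      refine ⟨hb, Reachable.trans (Adj.reachable ?_) hr⟩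
      simpa using huv
  have comp : ∀ {L : Set V} (hL : L ∈ F) {u : V} (hu : u ∈ L),
      Subtype.val '' ((G.induce (⋃₀ F)).connectedComponentMk ⟨u, L, hL, hu⟩).supp = L := by
    intro L hL u hu
    ext v
    constructor
    · rintro ⟨⟨v, hv⟩, hC, rfl⟩
      have hr : (G.induce (⋃₀ F)).Reachable ⟨u, L, hL, hu⟩ ⟨v, hv⟩ :=
        (ConnectedComponent.eq.1 hC).symm
      obtain ⟨p⟩ := hr.map (G.induceHomOfLE hsub).toHom
      exact (reach hL p hu).1
    · intro hv
      refine ⟨⟨v, L, hL, hv⟩, ConnectedComponent.eq.2 (Reachable.symm ?_), rfl⟩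
      obtain ⟨C, rfl⟩ := hF hL
      obtain ⟨⟨u, hu'⟩, hC, rfl⟩ := hu
      obtain ⟨⟨v, hv'⟩, hD, rfl⟩ := hv
      rw [ConnectedComponent.mem_supp_iff] at hC hD
      obtain ⟨p⟩ := ConnectedComponent.eq.1 (hC.trans hD.symm)
      exact (reach hL p ⟨_, hC, rfl⟩).2
  ext L
  constructor
  · rintro ⟨C, rfl⟩
    induction C using ConnectedComponent.ind with
    | h v =>
      obtain ⟨v, M, hM, hv⟩ := v
      rw [comp hM hv]
      exact hM
  · intro hL
    obtain ⟨u, hu⟩ := nonempty_of_mem_compsOn (hF hL)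
    exact ⟨_, (comp hL hu).symm⟩

theorem support_subset_of_mem_compsOn {X L : Set V} (hL : L ∈ CompsOn G X) {v y : V}
    (q : G.Walk v y) (hq : q.IsPath) (hX : ∀ u ∈ q.support, u ≠ y → u ∈ X) (hv : v ∈ L) :
    ∀ u ∈ q.support, u ≠ y → u ∈ L := by
  induction q with
  | nil => simp
  | @cons a b c h q ih =>
    intro u hu huy
    rw [Walk.support_cons, List.mem_cons] at hu
    rcases hu with rfl | hu
    · exact hv
    · by_cases hbc : b = c
      · subst hbc
        rw [(Walk.isPath_iff_nil.1 hq.of_cons).eq_nil, Walk.support_nil,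
          List.mem_singleton] at hu
        exact absurd hu huy
      · refine ih hq.of_cons (fun w hw => hX w (by simp [hw])) ?_ u hu huy
        exact mem_compsOn_of_adj hL hv (hX b (by simp) hbc) h

/-- The interior of a route lies in a single path of the constellation. -/
theorem IsRoute.exists_interior_subset {S : Set V} (hS : ∀ x ∈ S, ∀ y ∈ S, ¬ G.Adj x y)
    {x y : V} {p : G.Walk x y} (hp : IsRoute G Set.univ S p) :
    ∃ L ∈ CompsOn G (Set.univ \ S), ∀ v ∈ p.support, v ≠ x → v ≠ y → v ∈ L := by
  cases p with
  | nil => exact absurd rfl hp.ne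
  | @cons _ b _ h q =>
    have hbS : b ∉ S := fun hb => hS _ hp.fst_mem _ hb h
    have hpath := (Walk.cons_isPath_iff _ _).1 hp.isPath
    have hX : ∀ u ∈ q.support, u ≠ y → u ∈ Set.univ \ S := fun u hu huy =>
      ⟨trivial, hp.interior u (by simp [hu]) (fun hux => hpath.2 (hux ▸ hu)) huy⟩
    obtain ⟨L, hL, hb⟩ := exists_mem_compsOn (G := G) (X := Set.univ \ S) ⟨trivial, hbS⟩
    refine ⟨L, hL, fun v hv hvx hvy => ?_⟩
    rw [Walk.support_cons, List.mem_cons] at hv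
    exact support_subset_of_mem_compsOn hL q hpath.1 hX hb v (hv.resolve_left hvx) hvy

end Components

section Routes

variable {V : Type} {G : SimpleGraph V} {S : Set V}

theorem IsRoute.reverse {W : Set V} {x y : V} {p : G.Walk x y} (hp : IsRoute G W S p) :
    IsRoute G W S p.reverse where
  ne := hp.ne.symm
  isPath := hp.isPath.reverse
  induced u v hu hv huv := by
    rw [Walk.toSubgraph_reverse]
    exact hp.induced u v (by simpa using hu) (by simpa using hv) huv
  support_mem v hv := hp.support_mem v (by simpa using hv)
  fst_mem := hp.snd_mem
  snd_mem := hp.fst_mem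
  interior v hv hx hy := hp.interior v (by simpa using hv) hy hx

theorem IsRoute.two_le_length {W : Set V} (hS : ∀ x ∈ S, ∀ y ∈ S, ¬ G.Adj x y) {x y : V}
    {p : G.Walk x y} (hp : IsRoute G W S p) : 2 ≤ p.length := by
  by_contra! h
  interval_cases hl : p.length
  · exact hp.ne (Walk.eq_of_length_eq_zero hl)
  · exact hS _ hp.fst_mem _ hp.snd_mem (Walk.adj_of_length_eq_one hl)

/-- Routes between all pairs of vertices `b i`, through pairwise distinct paths of the
constellation and each anticomplete to the remaining `b k`, form a proper subdivision of a
complete graph. -/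
theorem exists_isSubdivisionWith_of_symm (hS : ∀ x ∈ S, ∀ y ∈ S, ¬ G.Adj x y) {m : ℕ}
    {b : Fin m → V} (hb : Function.Injective b) (hbS : ∀ i, b i ∈ S)
    (Q : ∀ i j : Fin m, i ≠ j → G.Walk (b i) (b j))
    (hQ : ∀ i j (h : i ≠ j), IsRoute G Set.univ S (Q i j h))
    (hsymm : ∀ i j (h : i ≠ j), Q j i h.symm = (Q i j h).reverse)
    (havoid : ∀ i j (h : i ≠ j) k, k ≠ i → k ≠ j → ∀ v ∈ (Q i j h).support, ¬ G.Adj (b k) v)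
    (L : Sym2 (Fin m) → Set V) (hL : ∀ i j : Fin m, i ≠ j → L s(i, j) ∈ CompsOn G (Set.univ \ S))
    (hinj : ∀ i j i' j' : Fin m, i ≠ j → i' ≠ j' → L s(i, j) = L s(i', j') → s(i, j) = s(i', j'))
    (hint : ∀ i j (h : i ≠ j), ∀ v ∈ (Q i j h).support, v ≠ b i → v ≠ b j → v ∈ L s(i, j)) :
    ∃ X : Set V, IsSubdivisionWith (G.induce X) (⊤ : SimpleGraph (Fin m)) (fun n => 2 ≤ n) := by
  set X : Set V := {v | (∃ w, v = b w) ∨ ∃ i j, ∃ h : i ≠ j, v ∈ (Q i j h).support}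
  have hX : ∀ i j (h : i ≠ j), ∀ v ∈ (Q i j h).support, v ∈ X := fun i j h v hv =>
    Or.inr ⟨i, j, h, hv⟩
  have hmem : ∀ {i j} (h : i ≠ j) (x : X),
      x ∈ ((Q i j h).induce X (hX i j h)).support ↔ x.1 ∈ (Q i j h).support := by
    intro i j h x
    simp [Walk.support_induce]
  have hadj : ∀ {i j} (h : i ≠ j) (x y : X), (Q i j h).toSubgraph.Adj x.1 y.1 →
      ((Q i j h).induce X (hX i j h)).toSubgraph.Adj x y := by
    intro i j h x y hxy
    rw [Walk.adj_toSubgraph_iff_mem_edges] at hxy ⊢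
    have hm := (Walk.edges_map (Embedding.induce X).toHom _).symm.trans
      (congrArg Walk.edges (Walk.map_induce (Q i j h) (hX i j h)))
    obtain ⟨e, he, hxy⟩ := List.mem_map.1
      ((congrArg (fun l : List (Sym2 V) => s(x.1, y.1) ∈ l) hm).mpr hxy)
    have : e = s(x, y) := Sym2.map.injective Subtype.val_injective hxy
    exact this ▸ he
  refine ⟨X, ⟨{
    b := fun i => ⟨b i, Or.inl ⟨i, rfl⟩⟩
    b_inj := fun i j hij => hb (congrArg Subtype.val hij)
    path := fun i j h => (Q i j h).induce X (hX i j h)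
    path_isPath := ?_
    path_len := ?_
    path_symm := ?_
    branch_avoid := ?_
    interiors_anticomplete := ?_
    cover := ?_
    edges_eq := ?_ }⟩⟩
  · intro i j h
    refine Walk.IsPath.of_map (f := (Embedding.induce X).toHom) ?_
    rw [Walk.map_induce]
    exact (hQ i j h).isPath
  · intro i j h
    have := congrArg Walk.length (Walk.map_induce (Q i j h) (hX i j h))
    rw [Walk.length_map] at this
    exact this ▸ (hQ i j h).two_le_length hS
  · intro i j h
    refine Walk.map_injective_of_injective (f := (Embedding.induce X).toHom)
      Subtype.val_injective _ _ ?_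
    rw [Walk.map_induce, ← Walk.reverse_map, Walk.map_induce]
    exact hsymm i j h
  · intro i j h w hw
    rw [hmem] at hw
    by_contra! hne
    exact (hQ i j h).interior _ hw (hb.ne hne.1) (hb.ne hne.2) (hbS w)
  · intro i j i' j' h h' hne x hx hxi hxj y hy hyi hyj
    rw [hmem] at hx hy
    rw [Ne, Subtype.ext_iff] at hxi hxj hyi hyj
    have hxL := hint i j h _ hx hxi hxj
    have hyL := hint i' j' h' _ hy hyi hyj
    have hLL : L s(i, j) ≠ L s(i', j') := fun h'' => hne (hinj i j i' j' h h' h'')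
    refine ⟨?_, fun hxy => hLL ?_⟩
    · rintro rfl
      exact hLL (compsOn_eq_of_mem (hL i j h) (hL i' j' h') hxL hyL)
    · exact compsOn_eq_of_mem (hL i j h) (hL i' j' h') (mem_compsOn_of_adj (hL i j h) hxL
        (subset_of_mem_compsOn (hL i' j' h') hyL) (by simpa using hxy)) hyL
  · rintro ⟨x, ⟨w, rfl⟩ | ⟨i, j, h, hx⟩⟩
    · exact Or.inl ⟨w, rfl⟩
    · exact Or.inr ⟨i, j, h, (hmem h _).2 hx⟩
  · have cases : ∀ x : X, (∃ w, x.1 = b w) ∨ ∃ i j, ∃ h : i ≠ j, x.1 ∈ (Q i j h).support ∧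
        x.1 ∈ L s(i, j) := by
      rintro ⟨x, ⟨w, rfl⟩ | ⟨i, j, h, hx⟩⟩
      · exact Or.inl ⟨w, rfl⟩
      · by_cases hi : x = b i
        · exact Or.inl ⟨i, hi⟩
        by_cases hj : x = b j
        · exact Or.inl ⟨j, hj⟩
        exact Or.inr ⟨i, j, h, hx, hint i j h x hx hi hj⟩
    have branch : ∀ (w : Fin m) {i j : Fin m} (h : i ≠ j) (v : V), v ∈ (Q i j h).support →
        G.Adj (b w) v → b w ∈ (Q i j h).support := by
      intro w i j h v hv hwv
      by_cases hi : w = i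
      · subst hi; simp
      by_cases hj : w = j
      · subst hj; simp
      exact absurd hwv (havoid i j h w hi hj v hv)
    intro x y hxy
    have hxy' : G.Adj x.1 y.1 := by simpa using hxy
    rcases cases x with ⟨w, hw⟩ | ⟨i, j, h, hx, hxL⟩
    · rcases cases y with ⟨w', hw'⟩ | ⟨i, j, h, hy, -⟩
      · exact absurd hxy' (hw ▸ hw' ▸ hS _ (hbS w) _ (hbS w'))
      · exact ⟨i, j, h, hadj h x y ((hQ i j h).induced _ _
          (hw ▸ branch w h _ hy (hw ▸ hxy')) hy hxy')⟩
    · rcases cases y with ⟨w', hw'⟩ | ⟨i', j', h', hy, hyL⟩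
      · exact ⟨i, j, h, hadj h x y ((hQ i j h).induced _ _ hx
          (hw' ▸ branch w' h _ hx (hw' ▸ hxy'.symm)) hxy')⟩
      · have hLL := compsOn_eq_of_mem (hL i j h) (hL i' j' h') (mem_compsOn_of_adj (hL i j h) hxL
          (subset_of_mem_compsOn (hL i' j' h') hyL) hxy') hyL
        have hy' : y.1 ∈ (Q i j h).support := by
          rcases Sym2.eq_iff.1 (hinj i j i' j' h h' hLL) with ⟨rfl, rfl⟩ | ⟨rfl, rfl⟩
          · exact hy
          · rw [hsymm _ _ h']
            simpa using hy
        exact ⟨i, j, h, hadj h x y ((hQ i j h).induced _ _ hx hy' hxy')⟩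

theorem exists_isSubdivisionWith (hS : ∀ x ∈ S, ∀ y ∈ S, ¬ G.Adj x y) {m : ℕ}
    {b : Fin m → V} (hb : Function.Injective b) (hbS : ∀ i, b i ∈ S)
    (P : ∀ i j : Fin m, i < j → G.Walk (b i) (b j))
    (hP : ∀ i j (h : i < j), IsRoute G Set.univ S (P i j h))
    (havoid : ∀ i j (h : i < j) k, k ≠ i → k ≠ j → ∀ v ∈ (P i j h).support, ¬ G.Adj (b k) v)
    (L : Sym2 (Fin m) → Set V) (hL : ∀ e, L e ∈ CompsOn G (Set.univ \ S))
    (hinj : Function.Injective L)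
    (hint : ∀ i j (h : i < j), ∀ v ∈ (P i j h).support, v ≠ b i → v ≠ b j → v ∈ L s(i, j)) :
    ∃ X : Set V, IsSubdivisionWith (G.induce X) (⊤ : SimpleGraph (Fin m)) (fun n => 2 ≤ n) := by
  let Q : ∀ i j : Fin m, i ≠ j → G.Walk (b i) (b j) := fun i j h =>
    if hij : i < j then P i j hij
    else (P j i (lt_of_le_of_ne (not_lt.1 hij) h.symm)).reverse
  have hQ1 : ∀ i j (h : i ≠ j) (hij : i < j), Q i j h = P i j hij := fun i j h hij => dif_pos hij
  have hQ2 : ∀ i j (h : i ≠ j) (hij : j < i), Q i j h = (P j i hij).reverse :=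
    fun i j h hij => dif_neg hij.not_gt
  refine exists_isSubdivisionWith_of_symm hS hb hbS Q ?_ ?_ ?_ L (fun i j _ => hL _)
    (fun i j i' j' _ _ h => hinj h) ?_
  · intro i j h
    rcases lt_or_gt_of_ne h with hij | hij
    · rw [hQ1 i j h hij]; exact hP i j hij
    · rw [hQ2 i j h hij]; exact (hP j i hij).reverse
  · intro i j h
    rcases lt_or_gt_of_ne h with hij | hij
    · rw [hQ1 i j h hij, hQ2 j i h.symm hij]
    · rw [hQ2 i j h hij, hQ1 j i h.symm hij, Walk.reverse_reverse]
  · intro i j h k hki hkj v hv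
    rcases lt_or_gt_of_ne h with hij | hij
    · rw [hQ1 i j h hij] at hv
      exact havoid i j hij k hki hkj v hv
    · rw [hQ2 i j h hij] at hv
      exact havoid j i hij k hkj hki v (by simpa using hv)
  · intro i j h v hv hvi hvj
    rcases lt_or_gt_of_ne h with hij | hij
    · rw [hQ1 i j h hij] at hv
      exact hint i j hij v hv hvi hvj
    · rw [hQ2 i j h hij] at hv
      rw [Sym2.eq_swap]
      exact hint j i hij v (by simpa using hv) hvj hvi

/-- Vertices from pairwise distinct paths of the constellation with `r` common neighbors in the
stable set give an induced `K_{r,r}`. -/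
theorem hasInducedSubgraphIso_completeBipartiteGraph (hS : ∀ x ∈ S, ∀ y ∈ S, ¬ G.Adj x y)
    {ι : Type} {r : ℕ} {lam : ι → Set V} (hlam : Function.Injective lam)
    (hL : ∀ i, lam i ∈ CompsOn G (Set.univ \ S)) {Z : Finset V} (hZS : ∀ z ∈ Z, z ∈ S)
    (hZ : Z.card = r) {I : Finset ι} (hI : r ≤ I.card) (v : ι → V)
    (hv : ∀ i ∈ I, v i ∈ lam i) (hadj : ∀ i ∈ I, ∀ z ∈ Z, G.Adj z (v i)) :
    HasInducedSubgraphIso G (completeBipartiteGraph (Fin r) (Fin r)) := by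
  obtain ⟨J, hJI, hJ⟩ := Finset.exists_subset_card_eq hI
  let eZ := (Z.equivFinOfCardEq hZ).symm
  let eJ := (J.equivFinOfCardEq hJ).symm
  have hJm : ∀ j, v (eJ j) ∈ lam (eJ j) := fun j => hv _ (hJI (eJ j).2)
  have hnS : ∀ j, v (eJ j) ∉ S := fun j => (subset_of_mem_compsOn (hL _) (hJm j)).2
  have hsep : ∀ j j', v (eJ j) = v (eJ j') ∨ G.Adj (v (eJ j)) (v (eJ j')) → j = j' := by
    intro j j' h
    refine eJ.injective (Subtype.ext (hlam (compsOn_eq_of_mem (hL _) (hL _) ?_ (hJm j'))))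
    rcases h with h | h
    · exact h ▸ hJm j
    · exact mem_compsOn_of_adj (hL _) (hJm j) ⟨trivial, hnS j'⟩ h
  have hcross : ∀ i j, G.Adj (eZ i) (v (eJ j)) := fun i j => hadj _ (hJI (eJ j).2) _ (eZ i).2
  let f : Fin r ⊕ Fin r → V := Sum.elim (fun i => eZ i) (fun j => v (eJ j))
  have hf : Function.Injective f := by
    rintro (i | i) (j | j) h
    · exact congrArg _ (eZ.injective (Subtype.ext h))
    · exact absurd ((show (eZ i : V) = v (eJ j) from h) ▸ hZS _ (eZ i).2) (hnS j)
    · exact absurd ((show v (eJ i) = (eZ j : V) from h) ▸ hZS _ (eZ j).2) (hnS i)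
    · exact congrArg _ (hsep i j (Or.inl h))
  have hfadj : ∀ a b, G.Adj (f a) (f b) ↔ (completeBipartiteGraph (Fin r) (Fin r)).Adj a b := by
    rintro (i | i) (j | j)
    · simpa [f] using hS _ (hZS _ (eZ i).2) _ (hZS _ (eZ j).2)
    · simpa [f] using hcross i j
    · simpa [f] using (hcross j i).symm
    · suffices ¬ G.Adj (v (eJ i)) (v (eJ j)) by simpa [f] using this
      intro h
      obtain rfl := hsep i j (Or.inr h)
      exact G.loopless.irrefl _ h
  let φ : completeBipartiteGraph (Fin r) (Fin r) ↪g G := ⟨⟨f, hf⟩, hfadj _ _⟩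
  exact ⟨_, ⟨φ.isoInduceRange⟩⟩

end Routes

section Colors

variable {V : Type} {G : SimpleGraph V} {S : Set V}

/-- `p` is a route whose interior is contained in `L`. -/
structure IsRouteThrough (G : SimpleGraph V) (S L : Set V) {x y : V} (p : G.Walk x y) : Prop where
  isRoute : IsRoute G Set.univ S p
  interior_subset : ∀ v ∈ p.support, v ≠ x → v ≠ y → v ∈ L

variable [LinearOrder V]

/-- Some route through `L` joins the two splitting elements of `A` and is anticomplete to the
other elements of `A`. -/
def HasAvoidingRoute (G : SimpleGraph V) (S L : Set V) (n : ℕ) (A : Finset V) : Prop :=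
  ∃ x y, IsSplit A n x y ∧ ∃ p : G.Walk x y, IsRouteThrough G S L p ∧
    ∀ z ∈ A, z ≠ x → z ≠ y → ∀ v ∈ p.support, ¬ G.Adj z v

/-- Some route of length at most `d + 1` through `L` joins the two splitting elements of `A`. -/
def HasShortRoute (G : SimpleGraph V) (S L : Set V) (n d : ℕ) (A : Finset V) : Prop :=
  ∃ x y, IsSplit A n x y ∧ ∃ p : G.Walk x y, IsRouteThrough G S L p ∧ p.length ≤ d + 1

theorem exists_adj_of_forall_not_hasAvoidingRoute {L : Set V} {n : ℕ} {T : Finset V}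
    (hno : ∀ A ⊆ T, A.card = 3 * n + 2 → ¬ HasAvoidingRoute G S L n A) {x y : V} (hx : x ∈ T)
    (hy : y ∈ T) (hxy : x < y) {p : G.Walk x y} (hp : IsRouteThrough G S L p)
    {Qm Q Qp : Finset V} (hmT : Qm ⊆ T) (hqT : Q ⊆ T) (hpT : Qp ⊆ T) (hm : ∀ z ∈ Qm, z < x)
    (hq : ∀ z ∈ Q, x < z ∧ z < y) (hqp : ∀ z ∈ Qp, y < z) (cm : Qm.card = n) (cq : Q.card = n)
    (cp : Qp.card = n) : ∃ z ∈ Qm ∪ Q ∪ Qp, ∃ v ∈ p.support, G.Adj z v := by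
  by_contra! h
  obtain ⟨hs, hc⟩ := isSplit_insert_union hxy hm hq hqp cm cq cp
  refine hno _ ?_ hc ⟨x, y, hs, p, hp, fun z hz hzx hzy v hv => h z ?_ v hv⟩
  · exact Finset.insert_subset hx (Finset.insert_subset hy
      (Finset.union_subset (Finset.union_subset hmT hqT) hpT))
  · exact (Finset.mem_insert.1 ((Finset.mem_insert.1 hz).resolve_left hzx)).resolve_left hzy

theorem HasAvoidingRoute.exists_route {L : Set V} {n : ℕ} {A : Finset V}
    (h : HasAvoidingRoute G S L n A) {x y : V} (hs : IsSplit A n x y) :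
    ∃ p : G.Walk x y, IsRouteThrough G S L p ∧
      ∀ z ∈ A, z ≠ x → z ≠ y → ∀ v ∈ p.support, ¬ G.Adj z v := by
  obtain ⟨x', y', hs', h⟩ := h
  obtain ⟨rfl, rfl⟩ := hs.unique hs'
  exact h

theorem HasShortRoute.exists_route {L : Set V} {n d : ℕ} {A : Finset V}
    (h : HasShortRoute G S L n d A) {x y : V} (hs : IsSplit A n x y) :
    ∃ p : G.Walk x y, IsRouteThrough G S L p ∧ p.length ≤ d + 1 := by
  obtain ⟨x', y', hs', h⟩ := h
  obtain ⟨rfl, rfl⟩ := hs.unique hs'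
  exact h

/-- Given room around `x < y` in `T`, one can choose a split of `T` at `x`, `y` whose parts contain
prescribed small sets. -/
theorem exists_isSplit_superset {n : ℕ} {T : Finset V} {x y : V} (hx : x ∈ T) (hy : y ∈ T)
    (hxy : x < y) (h1 : n ≤ (T.filter (· < x)).card)
    (h2 : n ≤ (T.filter (fun z => x < z ∧ z < y)).card) (h3 : n ≤ (T.filter (y < ·)).card)
    {Bm B Bp : Finset V} (hBm : Bm ⊆ T.filter (· < x))
    (hB : B ⊆ T.filter (fun z => x < z ∧ z < y)) (hBp : Bp ⊆ T.filter (y < ·))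
    (cm : Bm.card ≤ n) (c : B.card ≤ n) (cp : Bp.card ≤ n) :
    ∃ A ⊆ T, A.card = 3 * n + 2 ∧ IsSplit A n x y ∧ Bm ⊆ A ∧ B ⊆ A ∧ Bp ⊆ A := by
  obtain ⟨Qm, hQm, hQmT, cm⟩ := Finset.exists_subsuperset_card_eq hBm cm h1
  obtain ⟨Q, hQ, hQT, c⟩ := Finset.exists_subsuperset_card_eq hB c h2
  obtain ⟨Qp, hQp, hQpT, cp⟩ := Finset.exists_subsuperset_card_eq hBp cp h3
  obtain ⟨hs, hc⟩ := isSplit_insert_union hxy (fun z hz => (Finset.mem_filter.1 (hQmT hz)).2)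
    (fun z hz => (Finset.mem_filter.1 (hQT hz)).2) (fun z hz => (Finset.mem_filter.1 (hQpT hz)).2)
    cm c cp
  refine ⟨_, ?_, hc, hs, ?_, ?_, ?_⟩
  · refine Finset.insert_subset hx (Finset.insert_subset hy
      (Finset.union_subset (Finset.union_subset ?_ ?_) ?_)) <;>
    exact Finset.Subset.trans ‹_› (Finset.filter_subset _ _)
  all_goals
    intro z hz
    simp only [Finset.mem_insert, Finset.mem_union]
  · exact Or.inr (Or.inr (Or.inl (Or.inl (hQm hz))))
  · exact Or.inr (Or.inr (Or.inl (Or.inr (hQ hz))))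
  · exact Or.inr (Or.inr (Or.inr (hQp hz)))

theorem exists_isSubdivisionWith_of_hasAvoidingRoute (hS : ∀ x ∈ S, ∀ y ∈ S, ¬ G.Adj x y)
    {ι : Type} {lam : ι → Set V} (hlam : Function.Injective lam)
    (hL : ∀ i, lam i ∈ CompsOn G (Set.univ \ S)) {T : Finset V} (hTS : ∀ z ∈ T, z ∈ S)
    {n : ℕ} (hT : (n + 1) * (n + 3) < T.card) {I : Finset ι}
    (hI : Fintype.card (Sym2 (Fin (n + 2))) ≤ I.card)
    (hyes : ∀ i ∈ I, ∀ A ⊆ T, A.card = 3 * n + 2 → HasAvoidingRoute G S (lam i) n A) :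
    ∃ X : Set V, IsSubdivisionWith (G.induce X) (⊤ : SimpleGraph (Fin (n + 2)))
      (fun k => 2 ≤ k) := by
  obtain ⟨b, hb, hbT, h1, h2, h3⟩ := exists_spaced_sequence T n (n + 2) hT
  obtain ⟨σ⟩ : Nonempty (Sym2 (Fin (n + 2)) ↪ I) :=
    Function.Embedding.nonempty_of_card_le (by simpa using hI)
  have key : ∀ i j : Fin (n + 2), i < j → ∃ p : G.Walk (b i) (b j),
      IsRouteThrough G S (lam (σ s(i, j))) p ∧
      ∀ k, k ≠ i → k ≠ j → ∀ v ∈ p.support, ¬ G.Adj (b k) v := by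
    intro i j hij
    have hij' : (i : ℕ) < j := hij
    have himg : ∀ J : Finset (Fin (n + 2)), J.card ≤ n → (J.image b).card ≤ n :=
      fun J hJ => Finset.card_image_le.trans hJ
    obtain ⟨A, hAT, hA, hs, hm, hq, hp⟩ := exists_isSplit_superset (hbT i) (hbT j) (hb hij)
      (h1 i) (h2 i j hij) (h3 j) (Bm := (Finset.Iio i).image b) (B := (Finset.Ioo i j).image b)
      (Bp := (Finset.Ioi j).image b)
      (fun z hz => by
        obtain ⟨k, hk, rfl⟩ := Finset.mem_image.1 hz
        exact Finset.mem_filter.2 ⟨hbT k, hb (Finset.mem_Iio.1 hk)⟩)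
      (fun z hz => by
        obtain ⟨k, hk, rfl⟩ := Finset.mem_image.1 hz
        exact Finset.mem_filter.2 ⟨hbT k, hb (Finset.mem_Ioo.1 hk).1, hb (Finset.mem_Ioo.1 hk).2⟩)
      (fun z hz => by
        obtain ⟨k, hk, rfl⟩ := Finset.mem_image.1 hz
        exact Finset.mem_filter.2 ⟨hbT k, hb (Finset.mem_Ioi.1 hk)⟩)
      (himg _ (by rw [Fin.card_Iio]; omega)) (himg _ (by rw [Fin.card_Ioo]; omega))
      (himg _ (by rw [Fin.card_Ioi]; omega))
    obtain ⟨p, hpL, hav⟩ := (hyes _ (σ s(i, j)).2 A hAT hA).exists_route hs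
    refine ⟨p, hpL, fun k hki hkj => hav (b k) ?_ (hb.injective.ne hki) (hb.injective.ne hkj)⟩
    rcases lt_or_gt_of_ne hki with h | h
    · exact hm (Finset.mem_image_of_mem _ (Finset.mem_Iio.2 h))
    rcases lt_or_gt_of_ne hkj with h' | h'
    · exact hq (Finset.mem_image_of_mem _ (Finset.mem_Ioo.2 ⟨h, h'⟩))
    · exact hp (Finset.mem_image_of_mem _ (Finset.mem_Ioi.2 h'))
  choose P hP hav using key
  exact exists_isSubdivisionWith hS hb.injective (fun i => hTS _ (hbT i)) P
    (fun i j h => (hP i j h).isRoute) hav (fun e => lam (σ e)) (fun e => hL _)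
    (fun e e' h => σ.injective (Subtype.ext (hlam h))) (fun i j h => (hP i j h).interior_subset)

/-- A short route meeting many neighborhoods has an interior vertex with many neighbors. -/
theorem exists_common_neighbor (hS : ∀ x ∈ S, ∀ y ∈ S, ¬ G.Adj x y) {L : Set V} {x y : V}
    {p : G.Walk x y} (hp : IsRouteThrough G S L p) {d r : ℕ} (hd : p.length ≤ d + 1)
    {R : Finset V} (hRS : ∀ z ∈ R, z ∈ S) (hR : ∀ z ∈ R, ∃ v ∈ p.support, G.Adj z v)
    (hcard : d * r < R.card) :
    ∃ v ∈ L, ∃ Z ⊆ R, Z.card = r ∧ ∀ z ∈ Z, G.Adj z v := by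
  choose! w hw hadj using hR
  set J := (p.support.toFinset.erase x).erase y with hJ
  have hwJ : ∀ z ∈ R, w z ∈ J := fun z hz => by
    refine Finset.mem_erase.2 ⟨fun h => ?_, Finset.mem_erase.2 ⟨fun h => ?_, by simpa using hw z hz⟩⟩
    · exact hS _ (hRS z hz) _ hp.isRoute.snd_mem (h ▸ hadj z hz)
    · exact hS _ (hRS z hz) _ hp.isRoute.fst_mem (h ▸ hadj z hz)
  have hJc : J.card ≤ d := by
    have h1 : p.support.toFinset.card ≤ d + 2 :=
      (List.toFinset_card_le _).trans (by rw [Walk.length_support]; omega)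
    rw [hJ, Finset.card_erase_of_mem, Finset.card_erase_of_mem]
    · omega
    · simp
    · simp [hp.isRoute.ne.symm]
  obtain ⟨z₀, hz₀⟩ := Finset.card_pos.1 (by omega : 0 < R.card)
  obtain ⟨v, hv, hfib⟩ := Finset.exists_le_card_fiber_of_mul_le_card_of_maps_to (n := r) hwJ
    ⟨_, hwJ z₀ hz₀⟩ ((Nat.mul_le_mul_right r hJc).trans hcard.le)
  obtain ⟨Z, hZ, hZc⟩ := Finset.exists_subset_card_eq hfib
  rw [hJ, Finset.mem_erase, Finset.mem_erase] at hv
  refine ⟨v, hp.interior_subset v (by simpa using hv.2.2) hv.2.1 hv.1, Z,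
    fun z hz => (Finset.mem_filter.1 (hZ hz)).1, hZc, fun z hz => ?_⟩
  obtain ⟨hzR, rfl⟩ := Finset.mem_filter.1 (hZ hz)
  exact hadj z hzR

theorem exists_common_neighbor_of_hasShortRoute (hS : ∀ x ∈ S, ∀ y ∈ S, ¬ G.Adj x y) {L : Set V}
    {T : Finset V} (hTS : ∀ z ∈ T, z ∈ S) {n d r : ℕ} (hT : (n + d * r + 1) * 3 < T.card)
    (hno : ∀ A ⊆ T, A.card = 3 * n + 2 → ¬ HasAvoidingRoute G S L n A)
    (hyes : ∀ A ⊆ T, A.card = 3 * n + 2 → HasShortRoute G S L n d A) :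
    ∃ v ∈ L, ∃ Z ⊆ T, Z.card = r ∧ ∀ z ∈ Z, G.Adj z v := by
  classical
  obtain ⟨b, hb, hbT, h1, h2, h3⟩ := exists_spaced_sequence T (n + d * r) 2 hT
  have h01 : (0 : Fin 2) < 1 := by decide
  have hn : n ≤ n + d * r := Nat.le_add_right _ _
  obtain ⟨A, hAT, hA, hs, -⟩ := exists_isSplit_superset (hbT 0) (hbT 1) (hb h01)
    (hn.trans (h1 0)) (hn.trans (h2 0 1 h01)) (hn.trans (h3 1)) (Finset.empty_subset _)
    (Finset.empty_subset _) (Finset.empty_subset _) (Nat.zero_le _) (Nat.zero_le _) (Nat.zero_le _)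
  obtain ⟨p, hp, hpd⟩ := (hyes A hAT hA).exists_route hs
  by_contra! hcon
  have region : ∀ R ⊆ T, n + d * r ≤ R.card →
      ∃ Q ⊆ R, Q.card = n ∧ ∀ z ∈ Q, ∀ v ∈ p.support, ¬ G.Adj z v := by
    intro R hR hRc
    have hnear : (R.filter (fun z => ∃ v ∈ p.support, G.Adj z v)).card ≤ d * r := by
      by_contra! hlt
      obtain ⟨v, hv, Z, hZ, hZc, hadj⟩ := exists_common_neighbor hS hp hpd
        (fun z hz => hTS z (hR (Finset.mem_filter.1 hz).1))
        (fun z hz => (Finset.mem_filter.1 hz).2) hlt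
      obtain ⟨z, hz, hzv⟩ := hcon v hv Z
        (fun z hz => hR (Finset.mem_filter.1 (hZ hz)).1) hZc
      exact hzv (hadj z hz)
    have hsum := R.card_filter_add_card_filter_not (fun z => ∃ v ∈ p.support, G.Adj z v)
    obtain ⟨Q, hQ, hQc⟩ := Finset.exists_subset_card_eq
      (s := R.filter (fun z => ¬ ∃ v ∈ p.support, G.Adj z v)) (n := n) (by omega)
    refine ⟨Q, fun z hz => (Finset.mem_filter.1 (hQ hz)).1, hQc, fun z hz v hv hzv => ?_⟩
    exact (Finset.mem_filter.1 (hQ hz)).2 ⟨v, hv, hzv⟩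
  obtain ⟨Qm, hQm, cm, am⟩ := region _ (Finset.filter_subset _ _) (h1 0)
  obtain ⟨Q, hQ, c, a⟩ := region _ (Finset.filter_subset _ _) (h2 0 1 h01)
  obtain ⟨Qp, hQp, cp, ap⟩ := region _ (Finset.filter_subset _ _) (h3 1)
  obtain ⟨z, hz, v, hv, hzv⟩ := exists_adj_of_forall_not_hasAvoidingRoute hno (hbT 0) (hbT 1)
    (hb h01) hp (hQm.trans (Finset.filter_subset _ _)) (hQ.trans (Finset.filter_subset _ _))
    (hQp.trans (Finset.filter_subset _ _)) (fun z hz => (Finset.mem_filter.1 (hQm hz)).2)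
    (fun z hz => (Finset.mem_filter.1 (hQ hz)).2) (fun z hz => (Finset.mem_filter.1 (hQp hz)).2)
    cm c cp
  rcases Finset.mem_union.1 hz with hz | hz
  · rcases Finset.mem_union.1 hz with hz | hz
    · exact am z hz v hv hzv
    · exact a z hz v hv hzv
  · exact ap z hz v hv hzv

theorem hasInducedSubgraphIso_of_hasShortRoute (hS : ∀ x ∈ S, ∀ y ∈ S, ¬ G.Adj x y)
    {ι : Type} {lam : ι → Set V} (hlam : Function.Injective lam)
    (hL : ∀ i, lam i ∈ CompsOn G (Set.univ \ S)) {T : Finset V} (hTS : ∀ z ∈ T, z ∈ S)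
    {n d r : ℕ} (hr : 0 < r) (hT : (n + d * r + 1) * 3 < T.card) {I : Finset ι}
    (hI : 2 ^ T.card * r ≤ I.card)
    (hno : ∀ i ∈ I, ∀ A ⊆ T, A.card = 3 * n + 2 → ¬ HasAvoidingRoute G S (lam i) n A)
    (hyes : ∀ i ∈ I, ∀ A ⊆ T, A.card = 3 * n + 2 → HasShortRoute G S (lam i) n d A) :
    HasInducedSubgraphIso G (completeBipartiteGraph (Fin r) (Fin r)) := by
  classical
  obtain ⟨i₀, -⟩ := Finset.card_pos.1 ((by positivity : 0 < 2 ^ T.card * r).trans_le hI)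
  have : Nonempty V := ⟨(nonempty_of_mem_compsOn (hL i₀)).some⟩
  choose! v hv Z hZT hZc hadj using fun i (hi : i ∈ I) =>
    exists_common_neighbor_of_hasShortRoute hS hTS hT (hno i hi) (hyes i hi)
  obtain ⟨Z₀, -, hZ₀⟩ := Finset.exists_le_card_fiber_of_mul_le_card_of_maps_to (s := I)
    (t := T.powerset) (f := Z) (n := r) (fun i hi => Finset.mem_powerset.2 (hZT i hi))
    ⟨∅, by simp⟩ (by simpa using hI)
  obtain ⟨i, hi⟩ := Finset.card_pos.1 (hr.trans_le hZ₀)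
  obtain ⟨hiI, hiZ⟩ := Finset.mem_filter.1 hi
  refine hasInducedSubgraphIso_completeBipartiteGraph hS hlam hL (Z := Z₀)
    (fun z hz => hTS z (hZT i hiI (hiZ ▸ hz))) (hiZ ▸ hZc i hiI) hZ₀ v
    (fun j hj => hv j (Finset.mem_filter.1 hj).1) (fun j hj z hz => ?_)
  obtain ⟨hjI, rfl⟩ := Finset.mem_filter.1 hj
  exact hadj j hjI z hz

end Colors

section Mixed

variable {V : Type} {G : SimpleGraph V} {S : Set V}

theorem sdiff_union_sUnion_compsOn {S' : Set V} (hS' : S' ⊆ S) {F : Set (Set V)}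
    (hF : F ⊆ CompsOn G (Set.univ \ S)) : (S' ∪ ⋃₀ F) \ S' = ⋃₀ F := by
  rw [Set.union_sdiff_left, sdiff_eq_left, Set.disjoint_left]
  rintro v ⟨L, hL, hv⟩ hvS
  exact (subset_of_mem_compsOn (hF hL) hv).2 (hS' hvS)

/-- Routes of a constellation formed by some vertices of `S` and some paths of `G \ S` are routes
through one of these paths. -/
theorem IsRoute.exists_isRouteThrough (hS : ∀ x ∈ S, ∀ y ∈ S, ¬ G.Adj x y) {S' : Set V}
    (hS' : S' ⊆ S) {F : Set (Set V)} (hF : F ⊆ CompsOn G (Set.univ \ S)) {x y : V}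
    {p : G.Walk x y} (hp : IsRoute G (S' ∪ ⋃₀ F) S' p) : ∃ L ∈ F, IsRouteThrough G S L p := by
  have hint : ∀ v ∈ p.support, v ≠ x → v ≠ y → v ∈ ⋃₀ F := fun v hv hvx hvy =>
    (hp.support_mem v hv).resolve_left (hp.interior v hv hvx hvy)
  have hroute : IsRoute G Set.univ S p :=
    { ne := hp.ne
      isPath := hp.isPath
      induced := hp.induced
      support_mem := fun _ _ => trivial
      fst_mem := hS' hp.fst_mem
      snd_mem := hS' hp.snd_mem
      interior := fun v hv hvx hvy => by
        obtain ⟨L, hL, hvL⟩ := hint v hv hvx hvy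
        exact (subset_of_mem_compsOn (hF hL) hvL).2 }
  obtain ⟨M, hM, hMint⟩ := hroute.exists_interior_subset hS
  obtain ⟨v, hv, hvx, hvy⟩ : ∃ v ∈ p.support, v ≠ x ∧ v ≠ y := by
    have h2 := hroute.two_le_length hS
    have hinj := hp.isPath.getVert_injOn
    refine ⟨p.getVert 1, p.getVert_mem_support 1, fun h => ?_, fun h => ?_⟩
    · have := hinj (show 1 ≤ p.length by omega) (show 0 ≤ p.length by omega)
        (h.trans p.getVert_zero.symm)
      omega
    · have := hinj (show 1 ≤ p.length by omega) (show p.length ≤ p.length by omega)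
        (h.trans p.getVert_length.symm)
      omega
  obtain ⟨L, hL, hvL⟩ := hint v hv hvx hvy
  obtain rfl := compsOn_eq_of_mem (hF hL) hM hvL (hMint v hv hvx hvy)
  exact ⟨L, hL, hroute, hMint⟩

theorem exists_mixed_constellation [LinearOrder V] [Fintype V]
    (hc : IsConstellationOn G Set.univ S) {F : Set (Set V)}
    (hF : F ⊆ CompsOn G (Set.univ \ S)) {T : Finset V} (hTS : ∀ z ∈ T, z ∈ S) {n d s : ℕ}
    (hT : (n + 1) * (s + 1) < T.card)
    (hno : ∀ L ∈ F, ∀ A ⊆ T, A.card = 3 * n + 2 → ¬ HasAvoidingRoute G S L n A)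
    (hlong : ∀ L ∈ F, ∀ A ⊆ T, A.card = 3 * n + 2 → ¬ HasShortRoute G S L n d A) :
    ∃ W' S' : Set V, IsConstellationOn G W' S' ∧ SitsIn G W' S' Set.univ S ∧
      DAmple G W' S' d ∧ Mixed G W' S' n n n ∧ S'.ncard = s ∧ CompsOn G (W' \ S') = F := by
  classical
  obtain ⟨b, hb, hbT, h1, h2, h3⟩ := exists_spaced_sequence T n s hT
  have hST : ∀ z ∈ Set.range b, z ∈ T := by
    rintro _ ⟨j, rfl⟩
    exact hbT j
  have hSS : Set.range b ⊆ S := fun z hz => hTS z (hST z hz)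
  have hcomps : CompsOn G ((Set.range b ∪ ⋃₀ F) \ Set.range b) = F := by
    rw [sdiff_union_sUnion_compsOn hSS hF, compsOn_sUnion hF]
  refine ⟨Set.range b ∪ ⋃₀ F, Set.range b, ⟨Set.subset_union_left, ?_, ?_, ?_⟩,
    ⟨Set.subset_univ _, hSS, ?_, ?_⟩, ?_, ?_, ?_, hcomps⟩
  · exact fun x hx y hy => hc.stable x (hSS hx) y (hSS hy)
  · rw [hcomps]
    exact fun L hL => hc.comp_paths L (hF hL)
  · rw [hcomps]
    exact fun x hx L hL => hc.dominates x (hSS hx) L (hF hL)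
  · rw [hcomps]
    exact fun L hL => ⟨L, hF hL, subset_rfl⟩
  · rw [hcomps]
    intro M hM L₁ hL₁ L₂ hL₂ h₁ h₂
    obtain ⟨u, hu⟩ := nonempty_of_mem_compsOn (hF hL₁)
    obtain ⟨v, hv⟩ := nonempty_of_mem_compsOn (hF hL₂)
    rw [compsOn_eq_of_mem (hF hL₁) hM hu (h₁ hu), compsOn_eq_of_mem (hF hL₂) hM hv (h₂ hv)]
  · have main : ∀ i j (p : G.Walk (b i) (b j)), i < j →
        IsRoute G (Set.range b ∪ ⋃₀ F) (Set.range b) p → d + 1 < p.length := by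
      intro i j p hij hp
      obtain ⟨L, hL, hpL⟩ := hp.exists_isRouteThrough hc.stable hSS hF
      obtain ⟨A, hAT, hA, hs, -⟩ := exists_isSplit_superset (hbT i) (hbT j) (hb hij)
        (h1 i) (h2 i j hij) (h3 j) (Finset.empty_subset _) (Finset.empty_subset _)
        (Finset.empty_subset _) (Nat.zero_le _) (Nat.zero_le _) (Nat.zero_le _)
      by_contra! hle
      exact hlong L hL A hAT hA ⟨_, _, hs, p, hpL, hle⟩
    intro x y p hp
    obtain ⟨i, rfl⟩ := hp.fst_mem
    obtain ⟨j, rfl⟩ := hp.snd_mem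
    rcases lt_trichotomy i j with hij | rfl | hij
    · exact main i j p hij hp
    · exact absurd rfl hp.ne
    · simpa using main j i p.reverse hij hp.reverse
  · let ord := (Fintype.orderIsoFinOfCardEq V rfl).symm
    refine ⟨fun v => (ord v : ℕ), (Fin.val_injective.comp ord.injective).injOn, ?_⟩
    simp only [Fin.val_fin_lt, OrderIso.lt_iff_lt]
    intro x hx y hy hxy p hp Qm Q Qp hQm hQ hQp cm c cp hm h hp'
    obtain ⟨L, hL, hpL⟩ := hp.exists_isRouteThrough hc.stable hSS hF
    obtain ⟨z, hz, hzv⟩ := exists_adj_of_forall_not_hasAvoidingRoute (hno L hL) (hST x hx)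
      (hST y hy) hxy hpL (Qm := Qm.toFinset) (Q := Q.toFinset) (Qp := Qp.toFinset)
      (fun z hz => hST z (hQm (by simpa using hz))) (fun z hz => hST z (hQ (by simpa using hz)))
      (fun z hz => hST z (hQp (by simpa using hz))) (fun z hz => hm z (by simpa using hz))
      (fun z hz => h z (by simpa using hz)) (fun z hz => hp' z (by simpa using hz))
      (by rw [← Set.ncard_eq_toFinset_card', cm]) (by rw [← Set.ncard_eq_toFinset_card', c])
      (by rw [← Set.ncard_eq_toFinset_card', cp])
    exact ⟨z, by simpa [or_assoc] using hz, hzv⟩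
  · rw [← Set.image_univ, Set.ncard_image_of_injective _ hb.injective]
    simp [Set.ncard_univ]

end Mixed

/-- Lemma 5.1: for all positive `d, l, r, s, t` there are `f, g` such
that every `(f,g)`-constellation contains `K_{r,r}` or a proper subdivision of
`K_{2t+2}` as an induced subgraph, or a `d`-ample `(2t,2t,2t)`-mixed
`(s,l)`-constellation sits in it. -/
theorem stmt8 (d l r s t : ℕ)
    (hd : 0 < d) (hl : 0 < l) (hr : 0 < r) (hs : 0 < s) (ht : 0 < t) :
    ∃ f g : ℕ, 0 < f ∧ 0 < g ∧
      ∀ (V : Type) [Fintype V] (G : SimpleGraph V) (S : Set V),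
        IsConstellationOn G Set.univ S →
        S.ncard = f → (CompsOn G (Set.univ \ S)).ncard = g →
          (HasInducedSubgraphIso G (completeBipartiteGraph (Fin r) (Fin r)) ∨
            ∃ X : Set V,
              IsSubdivisionWith (G.induce X) (⊤ : SimpleGraph (Fin (2 * t + 2)))
                (fun n => 2 ≤ n)) ∨
          (∃ W' S' : Set V, IsConstellationOn G W' S' ∧ SitsIn G W' S' Set.univ S ∧
              DAmple G W' S' d ∧ Mixed G W' S' (2 * t) (2 * t) (2 * t) ∧
              S'.ncard = s ∧ (CompsOn G (W' \ S')).ncard = l) := by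
  classical
  set M := (2 * t + 1) * (2 * t + 3) + (2 * t + d * r + 1) * 3 + (2 * t + 1) * (s + 1) + 1 with hM
  set n₁ := Fintype.card (Sym2 (Fin (2 * t + 2)))
  set n₂ := 2 ^ M * r
  obtain ⟨N, hN⟩ := exists_ramsey_number (Fin (n₁ + n₂ + l) → Prop × Prop) (3 * (2 * t) + 2) M
  refine ⟨N + 1, n₁ + n₂ + l, by omega, by omega, fun V _ G S hc hSf hLg => ?_⟩
  let : LinearOrder V := LinearOrder.lift' (Fintype.equivFin V) (Fintype.equivFin V).injective
  let e : Fin (n₁ + n₂ + l) ≃ CompsOn G (Set.univ \ S) :=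
    (Finite.equivFinOfCardEq (by rw [Nat.card_coe_set_eq, hLg])).symm
  set lam : Fin (n₁ + n₂ + l) → Set V := fun i => e i
  have hlam : Function.Injective lam := Subtype.val_injective.comp e.injective
  have hL : ∀ i, lam i ∈ CompsOn G (Set.univ \ S) := fun i => (e i).2
  obtain ⟨T, hTS, hTc, a, ha⟩ := hN V S.toFinset
    (fun A i => (HasAvoidingRoute G S (lam i) (2 * t) A, HasShortRoute G S (lam i) (2 * t) d A))
    (by rw [← Set.ncard_eq_toFinset_card', hSf]; omega)
  have hTS' : ∀ z ∈ T, z ∈ S := fun z hz => by simpa using hTS hz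
  have ha₁ : ∀ i, ∀ A ⊆ T, A.card = 3 * (2 * t) + 2 →
      (HasAvoidingRoute G S (lam i) (2 * t) A ↔ (a i).1) := fun i A hA hAc => by
    rw [← ha A hA hAc]
  have ha₂ : ∀ i, ∀ A ⊆ T, A.card = 3 * (2 * t) + 2 →
      (HasShortRoute G S (lam i) (2 * t) d A ↔ (a i).2) := fun i A hA hAc => by
    rw [← ha A hA hAc]
  set I₁ := Finset.univ.filter (fun i => (a i).1)
  set I₂ := (Finset.univ.filter (fun i => ¬ (a i).1)).filter (fun i => (a i).2)
  set I₃ := (Finset.univ.filter (fun i => ¬ (a i).1)).filter (fun i => ¬ (a i).2)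
  have hsum : I₁.card + (I₂.card + I₃.card) = n₁ + n₂ + l := by
    rw [Finset.card_filter_add_card_filter_not, Finset.card_filter_add_card_filter_not,
      Finset.card_univ, Fintype.card_fin]
  by_cases hI₁ : n₁ ≤ I₁.card
  · refine Or.inl (Or.inr (exists_isSubdivisionWith_of_hasAvoidingRoute hc.stable hlam hL hTS'
      (by rw [hTc, hM]; omega) hI₁ fun i hi A hA hAc => (ha₁ i A hA hAc).2 ?_))
    exact (Finset.mem_filter.1 hi).2
  by_cases hI₂ : n₂ ≤ I₂.card
  · refine Or.inl (Or.inl (hasInducedSubgraphIso_of_hasShortRoute (n := 2 * t) (d := d) hc.stable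
      hlam hL hTS' hr (by rw [hTc, hM]; omega) (I := I₂) (by rw [hTc]; exact hI₂)
      (fun i hi A hA hAc => ?_) (fun i hi A hA hAc => (ha₂ i A hA hAc).2 ?_)))
    · rw [ha₁ i A hA hAc]
      exact (Finset.mem_filter.1 (Finset.mem_filter.1 hi).1).2
    · exact (Finset.mem_filter.1 hi).2
  · obtain ⟨I, hI, hIc⟩ := Finset.exists_subset_card_eq (s := I₃) (n := l) (by omega)
    obtain ⟨W', S', h₁, h₂, h₃, h₄, h₅, h₆⟩ := exists_mixed_constellation (n := 2 * t) (d := d)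
      (s := s) hc (F := lam '' I) (by rintro _ ⟨i, -, rfl⟩; exact hL i) hTS'
      (by rw [hTc, hM]; omega)
      (by
        rintro _ ⟨i, hi, rfl⟩ A hA hAc
        rw [ha₁ i A hA hAc]
        exact (Finset.mem_filter.1 (Finset.mem_filter.1 (hI hi)).1).2)
      (by
        rintro _ ⟨i, hi, rfl⟩ A hA hAc
        rw [ha₂ i A hA hAc]
        exact (Finset.mem_filter.1 (hI hi)).2)
    refine Or.inr ⟨W', S', h₁, h₂, h₃, h₄, h₅, ?_⟩
    rw [h₆, Set.ncard_image_of_injective _ hlam, Set.ncard_coe_finset, hIc]
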